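/- For an affine process X on D = ℝ_{≥0}^m × ℝ^n with E^x[e^{⟨u,X_t⟩}] = e^{⟨x,Ψ(t,u)⟩}, and for any f with E^x|f(X_t)| < ∞ for all t, x, the following representation holds: u(t, x + hy) = E^x[v^{(t,y)}(h, X_t)] for all h > 0 and y ∈ D, where u(t,x) = E^x[f(X_t)] and v^{(t,y)}(h, z) = E[f(z + L^{(t,y)}_h)] is the semigroup of the Lévy process L^{(t,y)} whose time-1 law equals the law of X_t started at y. -/

import Mathlib

open MeasureTheory Filter
open scoped Topology

noncomputable section

/-- The canonical state space `D = ℝ_{≥0}^m × ℝ^{d-m}` inside `ℝ^d`. -/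
def canonicalD (d mm : ℕ) : Set (EuclideanSpace ℝ (Fin d)) :=
  {x | ∀ i : Fin d, (i : ℕ) < mm → 0 ≤ x i}

/-- The set `U` of complex exponents `u` for which `x ↦ e^{⟨x,u⟩}` is bounded on `D`:
`U = ℂ^m_{≤0} × iℝ^{d-m}`. -/
def canonicalU (d mm : ℕ) : Set (Fin d → ℂ) :=
  {u | (∀ i : Fin d, (i : ℕ) < mm → (u i).re ≤ 0) ∧
       (∀ i : Fin d, mm ≤ (i : ℕ) → (u i).re = 0)}

/-- The characteristic function is the Laplace-type transform at the purely imaginary exponent. -/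
theorem charFun_eq_integral_exp_sum {d : ℕ} (μ : Measure (EuclideanSpace ℝ (Fin d)))
    (s : EuclideanSpace ℝ (Fin d)) :
    charFun μ s =
      ∫ ξ, Complex.exp (∑ i, ((s i : ℂ) * Complex.I) * (ξ i : ℂ)) ∂μ := by
  rw [charFun_apply]
  congr 1 with ξ
  simp only [PiLp.inner_apply, RCLike.inner_apply, conj_trivial, Complex.ofReal_sum,
    Complex.ofReal_mul, Finset.sum_mul]
  congr 1
  exact Finset.sum_congr rfl fun i _ => by ring

theorem imaginary_mem_canonicalU {d : ℕ} (mm : ℕ) (s : EuclideanSpace ℝ (Fin d)) :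
    (fun i => (s i : ℂ) * Complex.I) ∈ canonicalU d mm := by
  constructor <;> simp

theorem add_smul_mem_canonicalD {d mm : ℕ} {x y : EuclideanSpace ℝ (Fin d)}
    (hx : x ∈ canonicalD d mm) (hy : y ∈ canonicalD d mm) {h : ℝ} (hh : 0 ≤ h) :
    x + h • y ∈ canonicalD d mm := fun i hi =>
  add_nonneg (hx i hi) (mul_nonneg hh (hy i hi))

/-- For an affine process `X` on `D` with
`E^x[e^{⟨u,X_t⟩}] = e^{⟨x,Ψ(t,u)⟩}` and any `f` with `E^x|f(X_t)| < ∞` for all `t,x`, one has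
`u(t, x + hy) = E^x[v^{(t,y)}(h, X_t)]` for `h > 0`, `y ∈ D`, where `u(t,x) = E^x[f(X_t)]`
and `v^{(t,y)}(h,z) = E[f(z + L^{(t,y)}_h)]` for the Lévy process `L^{(t,y)}` whose time-1
law is the law of `X_t` started at `y`.  Here `p t x` is the law of `X_t` under `ℙ^x` and
`μL t y h` the law of `L^{(t,y)}_h`. -/
theorem statement9 {d : ℕ} (mm : ℕ) (hmm : mm ≤ d)
    (p : ℝ → EuclideanSpace ℝ (Fin d) → Measure (EuclideanSpace ℝ (Fin d)))
    (hp : ∀ t x, IsProbabilityMeasure (p t x))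
    (μL : ℝ → EuclideanSpace ℝ (Fin d) → ℝ → Measure (EuclideanSpace ℝ (Fin d)))
    (hμL : ∀ t y h, IsProbabilityMeasure (μL t y h))
    (Ψ : ℝ → (Fin d → ℂ) → (Fin d → ℂ))
    -- the affine property of `X`:  `E^x[e^{⟨u,X_t⟩}] = e^{⟨x,Ψ(t,u)⟩}`
    (hchar : ∀ t : ℝ, 0 ≤ t → ∀ x ∈ canonicalD d mm, ∀ u ∈ canonicalU d mm,
      ∫ ξ, Complex.exp (∑ i, u i * (ξ i : ℂ)) ∂(p t x) =
        Complex.exp (∑ i, (x i : ℂ) * Ψ t u i))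
    -- `L^{(t,y)}` is a Lévy process whose time-1 law is the law of `X_t` started at `y`:
    -- `E[e^{⟨u,L^{(t,y)}_h⟩}] = e^{h⟨y,Ψ(t,u)⟩}`
    (hcharL : ∀ t : ℝ, 0 ≤ t → ∀ y ∈ canonicalD d mm, ∀ h : ℝ, 0 ≤ h →
      ∀ u ∈ canonicalU d mm,
      ∫ ξ, Complex.exp (∑ i, u i * (ξ i : ℂ)) ∂(μL t y h) =
        Complex.exp ((h : ℂ) * ∑ i, (y i : ℂ) * Ψ t u i))
    (f : EuclideanSpace ℝ (Fin d) → ℝ) (hf : Measurable f)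
    -- `E^x|f(X_t)| < ∞` for all `t ≥ 0`, `x ∈ D`
    (hint : ∀ t : ℝ, 0 ≤ t → ∀ x ∈ canonicalD d mm, Integrable f (p t x)) :
    ∀ t : ℝ, 0 ≤ t → ∀ h : ℝ, 0 < h →
      ∀ x ∈ canonicalD d mm, ∀ y ∈ canonicalD d mm,
        ∫ ξ, f ξ ∂(p t (x + h • y)) =
          ∫ z, (∫ ξ, f (z + ξ) ∂(μL t y h)) ∂(p t x) := by
  intro t ht h hh x hx y hy
  have hxy := add_smul_mem_canonicalD hx hy hh.le
  have hconv : p t (x + h • y) = Measure.conv (p t x) (μL t y h) := by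
    refine Measure.ext_of_charFun (funext fun s => ?_)
    have hs := imaginary_mem_canonicalU mm s
    rw [charFun_conv]
    simp only [charFun_eq_integral_exp_sum]
    rw [hchar t ht _ hxy _ hs, hchar t ht x hx _ hs, hcharL t ht y hy h hh.le _ hs,
      ← Complex.exp_add, Finset.mul_sum, ← Finset.sum_add_distrib]
    congr 1
    refine Finset.sum_congr rfl fun i _ => ?_
    simp only [PiLp.add_apply, PiLp.smul_apply, smul_eq_mul, Complex.ofReal_add,
      Complex.ofReal_mul]
    ring
  have hf_int := hint t ht _ hxy
  rw [hconv] at hf_int ⊢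
  exact integral_conv hf_int
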